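/- (Theorem 1.5, part 1) Let m ∈ ℝ, γ > 0 and W ∈ C²(ℝ). The uniform state φ_* = m is a stable critical point of ℰ over H¹_m(𝕋^N) — i.e., the second variation ∇²ℰ(m)(u,u) = ∫_{𝕋^N} ( γ⁻²|∇u|² + |∇(−Δ)^{-1}u|² + W''(m) u² ) dx is nonnegative for every u ∈ H¹(𝕋^N) with ∫ u dx = 0 — if and only if W''(m) + min_{k ∈ 2πℤ^N, k ≠ 0} ( |k|²/γ² + 1/|k|² ) ≥ 0. -/

import Mathlib

open MeasureTheory Filter Real

noncomputable section

abbrev Pt (N : ℕ) := Fin N → ℝ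

/-- partial derivative in direction `i` -/
def pd {N : ℕ} (i : Fin N) (f : Pt N → ℝ) (x : Pt N) : ℝ := fderiv ℝ f x (Pi.single i 1)

/-- second partial derivative ∂ᵢ∂ⱼ -/
def pd2 {N : ℕ} (i j : Fin N) (f : Pt N → ℝ) : Pt N → ℝ := pd i (pd j f)

/-- the unit cube [0,1]^N, fundamental domain of the torus 𝕋^N -/
def cube (N : ℕ) : Set (Pt N) := Set.Icc 0 1

/-- Laplacian on the torus -/
def lap {N : ℕ} (f : Pt N → ℝ) (x : Pt N) : ℝ := ∑ i, pd2 i i f x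

/-- |∇f|² -/
def gradSq {N : ℕ} (f : Pt N → ℝ) (x : Pt N) : ℝ := ∑ i, (pd i f x)^2

/-- 1-periodicity in each coordinate: a function on the torus 𝕋^N -/
def ZPeriodic {N : ℕ} (f : Pt N → ℝ) : Prop :=
  ∀ (x : Pt N) (i : Fin N), f (x + Pi.single i 1) = f x

/-- min_{k ∈ 2πℤ^N, k ≠ 0} (α - |k|²)² -/
def freqMinPFC (N : ℕ) (α : ℝ) : ℝ :=
  sInf {t : ℝ | ∃ k : Fin N → ℤ, k ≠ 0 ∧ t = (α - 4*π^2 * ∑ i, ((k i : ℝ))^2)^2}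

/-- admissible test functions in the definition of P_N -/
def AdmissibleP {N : ℕ} (u : Pt N → ℝ) : Prop :=
  ContDiff ℝ 2 u ∧ ZPeriodic u ∧
    (∫ x in cube N, (u x)^3) = 1 ∧ (∫ x in cube N, u x) = 0

/-- the product (∫ (αu+Δu)² + c u²) · (∫ u⁴) -/
def Penergy {N : ℕ} (α c : ℝ) (u : Pt N → ℝ) : ℝ :=
  (∫ x in cube N, ((α * u x + lap u x)^2 + c * (u x)^2)) * (∫ x in cube N, (u x)^4)

/-- the optimal constant P_N (with c = W''(m)) -/
def PN (N : ℕ) (α c : ℝ) : ℝ :=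
  sInf {p : ℝ | ∃ u : Pt N → ℝ, AdmissibleP u ∧ p = Penergy α c u}

/-- membership in H²_m(𝕋^N) -/
def MemH2m {N : ℕ} (m : ℝ) (φ : Pt N → ℝ) : Prop :=
  ContDiff ℝ 2 φ ∧ ZPeriodic φ ∧ (∫ x in cube N, φ x) = m

/-- the PFC functional 𝓕 on the torus -/
def Fen {N : ℕ} (α : ℝ) (W : ℝ → ℝ) (φ : Pt N → ℝ) : ℝ :=
  ∫ x in cube N, ((1/2) * (α * φ x + lap φ x)^2 + W (φ x))

/-- ψ = (-Δ)⁻¹ u : the unique zero-average (periodic) solution of -Δψ = u -/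
def IsPotential {N : ℕ} (u ψ : Pt N → ℝ) : Prop :=
  ContDiff ℝ 2 ψ ∧ ZPeriodic ψ ∧ (∫ x in cube N, ψ x) = 0 ∧ ∀ x : Pt N, -lap ψ x = u x

/-- min_{k ∈ 2πℤ^N, k ≠ 0} (|k|²/γ² + 1/|k|²) -/
def freqMinOK (N : ℕ) (γ : ℝ) : ℝ :=
  sInf {t : ℝ | ∃ k : Fin N → ℤ, k ≠ 0 ∧
    t = (4*π^2 * ∑ i, ((k i : ℝ))^2) / γ^2 + 1 / (4*π^2 * ∑ i, ((k i : ℝ))^2)}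

/-- admissible test functions in the definition of Q_N -/
def AdmissibleQ {N : ℕ} (u : Pt N → ℝ) : Prop :=
  ContDiff ℝ 1 u ∧ ZPeriodic u ∧
    (∫ x in cube N, (u x)^3) = 1 ∧ (∫ x in cube N, u x) = 0

/-- the product (∫ γ⁻²|∇u|² + |∇(-Δ)⁻¹u|² + c u²) · (∫ u⁴), where ψ = (-Δ)⁻¹u -/
def Qenergy {N : ℕ} (γ c : ℝ) (u ψ : Pt N → ℝ) : ℝ :=
  (∫ x in cube N, ((1/γ^2) * gradSq u x + gradSq ψ x + c * (u x)^2)) *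
    (∫ x in cube N, (u x)^4)

/-- the optimal constant Q_N (with c = W''(m)) -/
def QN (N : ℕ) (γ c : ℝ) : ℝ :=
  sInf {q : ℝ | ∃ u ψ : Pt N → ℝ, AdmissibleQ u ∧ IsPotential u ψ ∧ q = Qenergy γ c u ψ}

/-- membership in H¹_m(𝕋^N) -/
def MemH1m {N : ℕ} (m : ℝ) (φ : Pt N → ℝ) : Prop :=
  ContDiff ℝ 1 φ ∧ ZPeriodic φ ∧ (∫ x in cube N, φ x) = m

/-- the Ohta–Kawasaki energy, expressed through ψ = (-Δ)⁻¹(φ - m) -/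
def Een {N : ℕ} (γ : ℝ) (W : ℝ → ℝ) (φ ψ : Pt N → ℝ) : ℝ :=
  ∫ x in cube N, ((1/(2*γ^2)) * gradSq φ x + (1/2) * gradSq ψ x + W (φ x))


/-! ### Helpers: phases and the trigonometric functions -/

/-- phase `2π k·x` -/
def phase {N : ℕ} (k : Fin N → ℤ) (x : Pt N) : ℝ := 2 * π * ∑ i, (k i : ℝ) * x i

/-- `cos (2π k·x)` -/
def cosK {N : ℕ} (k : Fin N → ℤ) (x : Pt N) : ℝ := Real.cos (phase k x)

/-- `sin (2π k·x)` -/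
def sinK {N : ℕ} (k : Fin N → ℤ) (x : Pt N) : ℝ := Real.sin (phase k x)

lemma phase_contDiff {N : ℕ} (k : Fin N → ℤ) {n : WithTop ℕ∞} : ContDiff ℝ n (phase k) := by
  unfold phase
  fun_prop

lemma cosK_contDiff {N : ℕ} (k : Fin N → ℤ) {n : WithTop ℕ∞} : ContDiff ℝ n (cosK k) :=
  Real.contDiff_cos.comp (phase_contDiff k)

lemma sinK_contDiff {N : ℕ} (k : Fin N → ℤ) {n : WithTop ℕ∞} : ContDiff ℝ n (sinK k) :=
  Real.contDiff_sin.comp (phase_contDiff k)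

lemma phase_add {N : ℕ} (k : Fin N → ℤ) (x y : Pt N) :
    phase k (x + y) = phase k x + phase k y := by
  simp only [phase, Pi.add_apply, mul_add, Finset.sum_add_distrib]

lemma phase_smul {N : ℕ} (k : Fin N → ℤ) (c : ℝ) (y : Pt N) :
    phase k (c • y) = c * phase k y := by
  simp only [phase, Pi.smul_apply, smul_eq_mul, Finset.mul_sum]
  exact Finset.sum_congr rfl fun i _ => by ring

lemma phase_single {N : ℕ} (k : Fin N → ℤ) (i : Fin N) :
    phase k (Pi.single i 1) = 2 * π * k i := by
  simp [phase, Pi.single_apply]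

/-- the phase as a continuous linear map -/
def phaseL {N : ℕ} (k : Fin N → ℤ) : Pt N →L[ℝ] ℝ :=
  LinearMap.toContinuousLinearMap
    { toFun := phase k, map_add' := phase_add k, map_smul' := phase_smul k }

lemma phase_hasFDerivAt {N : ℕ} (k : Fin N → ℤ) (x : Pt N) :
    HasFDerivAt (phase k) (phaseL k) x := (phaseL k).hasFDerivAt

lemma cosK_periodic {N : ℕ} (k : Fin N → ℤ) : ZPeriodic (cosK k) := by
  intro x i
  simp only [cosK, phase_add, phase_single]
  rw [mul_comm (2 * π)]
  exact Real.cos_add_int_mul_two_pi _ _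

lemma sinK_periodic {N : ℕ} (k : Fin N → ℤ) : ZPeriodic (sinK k) := by
  intro x i
  simp only [sinK, phase_add, phase_single]
  rw [mul_comm (2 * π)]
  exact Real.sin_add_int_mul_two_pi _ _

lemma pd_cosK {N : ℕ} (k : Fin N → ℤ) (i : Fin N) (x : Pt N) :
    pd i (cosK k) x = -(2 * π * k i) * sinK k x := by
  have h := ((phase_hasFDerivAt k x).cos).fderiv
  have h2 : phaseL k (Pi.single i 1) = 2 * π * k i := phase_single k i
  unfold pd cosK sinK
  rw [h]
  simp only [smul_apply, h2, smul_eq_mul]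
  ring

lemma pd_sinK {N : ℕ} (k : Fin N → ℤ) (i : Fin N) (x : Pt N) :
    pd i (sinK k) x = (2 * π * k i) * cosK k x := by
  have h := ((phase_hasFDerivAt k x).sin).fderiv
  have h2 : phaseL k (Pi.single i 1) = 2 * π * k i := phase_single k i
  unfold pd cosK sinK
  rw [h]
  simp only [smul_apply, h2, smul_eq_mul]
  ring

/-! ### Generalities on partial derivatives -/

lemma pd_contDiff {N : ℕ} (i : Fin N) {f : Pt N → ℝ} {n : WithTop ℕ∞}
    (hf : ContDiff ℝ (n + 1) f) : ContDiff ℝ n (pd i f) := by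
  unfold pd
  exact (hf.fderiv_right le_rfl).clm_apply contDiff_const

lemma pd_continuous {N : ℕ} (i : Fin N) {f : Pt N → ℝ}
    (hf : ContDiff ℝ 1 f) : Continuous (pd i f) :=
  (pd_contDiff (n := 0) i (by simpa using hf)).continuous

lemma pd_periodic {N : ℕ} (i : Fin N) {f : Pt N → ℝ} (hp : ZPeriodic f) :
    ZPeriodic (pd i f) := by
  intro x j
  have h : (fun y => f (y + Pi.single j 1)) = f := funext fun y => hp y j
  unfold pd
  rw [← fderiv_comp_add_right, h]

lemma pd_mul {N : ℕ} (i : Fin N) {f g : Pt N → ℝ} (hf : ContDiff ℝ 1 f) (hg : ContDiff ℝ 1 g)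
    (x : Pt N) : pd i (fun y => f y * g y) x = pd i f x * g x + f x * pd i g x := by
  unfold pd
  have hf' := (hf.differentiable one_ne_zero) x
  have hg' := (hg.differentiable one_ne_zero) x
  rw [fderiv_fun_mul hf' hg']
  simp
  ring

lemma cube_compact (N : ℕ) : IsCompact (cube N) := isCompact_Icc

lemma intOn {N : ℕ} {f : Pt N → ℝ} (hf : Continuous f) : IntegrableOn f (cube N) :=
  hf.continuousOn.integrableOn_compact (cube_compact N)

lemma intMul {N : ℕ} {f g : Pt N → ℝ} (hf : Continuous f) (hg : Continuous g) :
    IntegrableOn (fun x => f x * g x) (cube N) := intOn (hf.mul hg)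

lemma intSq {N : ℕ} {f : Pt N → ℝ} (hf : Continuous f) :
    IntegrableOn (fun x => f x ^ 2) (cube N) := intOn (hf.pow 2)

lemma int_pd_zero {N : ℕ} (i : Fin N) {f : Pt N → ℝ} (hf : ContDiff ℝ 1 f)
    (hp : ZPeriodic f) : ∫ x in cube N, pd i f x = 0 := by
  obtain _ | n := N
  · exact i.elim0
  have hc := pd_continuous i hf
  have hsum : ∀ x : Pt (n + 1), ∑ j, (if j = i then fderiv ℝ f x else 0) (Pi.single j 1)
      = pd i f x := by
    intro x
    rw [Finset.sum_eq_single i]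
    · simp [pd]
    · intro j _ hj
      simp [hj]
    · simp
  have key := integral_divergence_of_hasFDerivAt_off_countable' (E := ℝ)
    (0 : Pt (n + 1)) 1 zero_le_one
    (fun j => if j = i then f else 0) (fun j x => if j = i then fderiv ℝ f x else 0) ∅
    Set.countable_empty
    (by
      intro j
      by_cases hj : j = i
      · simpa [hj] using hf.continuous.continuousOn
      · simp only [hj, if_false]
        exact continuousOn_const)
    (by
      intro x _ j
      by_cases hj : j = i
      · simpa [hj] using ((hf.differentiable one_ne_zero) x).hasFDerivAt
      · simp only [hj, if_false]
        exact hasFDerivAt_const (0 : ℝ) x)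
    (by
      simp only [hsum]
      exact intOn hc)
  simp only [hsum] at key
  unfold cube
  rw [key]
  refine Finset.sum_eq_zero fun j _ => ?_
  by_cases hj : j = i
  · subst hj
    simp only [if_true]
    rw [sub_eq_zero]
    congr 1
    ext x
    rw [← hp (j.insertNth ((0 : Pt (n + 1)) j) x) j]
    congr 1
    ext l
    refine Fin.succAboveCases j ?_ (fun l => ?_) l
    · simp
    · simp
  · simp [hj]

lemma ibp {N : ℕ} (i : Fin N) {f g : Pt N → ℝ} (hf : ContDiff ℝ 1 f) (hg : ContDiff ℝ 1 g)
    (hpf : ZPeriodic f) (hpg : ZPeriodic g) :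
    ∫ x in cube N, pd i f x * g x = -∫ x in cube N, f x * pd i g x := by
  have h := int_pd_zero i (hf.mul hg) (fun x j => by simp only [hpf x j, hpg x j])
  simp only [pd_mul i hf hg] at h
  rw [integral_add (intMul (pd_continuous i hf) hg.continuous)
    (intMul hf.continuous (pd_continuous i hg))] at h
  linarith

/-! ### Parseval -/

/-- cosine coefficient -/
def cA {N : ℕ} (f : Pt N → ℝ) (k : Fin N → ℤ) : ℝ := ∫ x in cube N, f x * cosK k x

/-- sine coefficient -/
def cB {N : ℕ} (f : Pt N → ℝ) (k : Fin N → ℤ) : ℝ := ∫ x in cube N, f x * sinK k x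

section Parseval

local instance instMSCircle : MeasureSpace UnitAddCircle := ⟨AddCircle.haarAddCircle⟩

local instance instHaarCircle : Measure.IsAddHaarMeasure (volume : Measure UnitAddCircle) :=
  inferInstanceAs (Measure.IsAddHaarMeasure AddCircle.haarAddCircle)

local instance instProbCircle : IsProbabilityMeasure (volume : Measure UnitAddCircle) :=
  inferInstanceAs (IsProbabilityMeasure AddCircle.haarAddCircle)

lemma torus_integral {N : ℕ} {E : Type*} [NormedAddCommGroup E] [NormedSpace ℝ E]
    (G : UnitAddTorus (Fin N) → E) (H : Pt N → E)
    (hGH : ∀ x : Pt N, (∀ i, x i ∈ Set.Ioc (0 : ℝ) 1) → G (fun i => (x i : UnitAddCircle)) = H x) :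
    ∫ t, G t = ∫ x in cube N, H x := by
  have h1 := UnitAddTorus.integral_preimage G 0
  have hset : {x : Fin N → ℝ | ∀ i, x i ∈ Set.Ioc ((0 : Fin N → ℝ) i) ((0 : Fin N → ℝ) i + 1)}
      = Set.pi Set.univ (fun i => Set.Ioc ((0 : Pt N) i) ((1 : Pt N) i)) := by
    ext x
    simp
  rw [hset] at h1
  rw [h1]
  have hm : MeasurableSet (Set.pi Set.univ (fun i => Set.Ioc ((0 : Pt N) i) ((1 : Pt N) i))) :=
    MeasurableSet.univ_pi fun i => measurableSet_Ioc
  rw [setIntegral_congr_fun hm (g := H)]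
  · unfold cube
    rw [volume_pi]
    exact setIntegral_congr_set Measure.univ_pi_Ioc_ae_eq_Icc
  · intro x hx
    exact hGH x (fun i => by simpa using hx i (Set.mem_univ i))

lemma mFourier_neg_mk {N : ℕ} (k : Fin N → ℤ) (x : Pt N) :
    UnitAddTorus.mFourier (-k) (fun i => (x i : UnitAddCircle))
      = (cosK k x : ℂ) - (sinK k x : ℂ) * Complex.I := by
  have h : UnitAddTorus.mFourier (-k) (fun i => (x i : UnitAddCircle))
      = ∏ i, fourier (-k i) (x i : UnitAddCircle) := rfl
  rw [h]
  simp only [fourier_coe_apply]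
  rw [← Complex.exp_sum]
  have : (∑ i, 2 * (π : ℂ) * Complex.I * ((-k i : ℤ) : ℂ) * (x i : ℂ) / ((1 : ℝ) : ℂ))
      = (-(phase k x : ℝ) : ℂ) * Complex.I := by
    simp only [phase]
    push_cast
    rw [Finset.mul_sum, ← Finset.sum_neg_distrib, Finset.sum_mul]
    refine Finset.sum_congr rfl fun i _ => ?_
    simp
    ring
  rw [this, Complex.exp_mul_I]
  simp [cosK, sinK]
  ring

lemma parseval {N : ℕ} {f : Pt N → ℝ} (hf : Continuous f) :
    HasSum (fun k => cA f k ^ 2 + cB f k ^ 2) (∫ x in cube N, f x ^ 2) := by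
  set R : UnitAddTorus (Fin N) → Pt N := fun y =>
    (UnitAddTorus.measurableEquivPiIoc (0 : Fin N → ℝ) y).1 with hR
  have hRm : Measurable R :=
    measurable_subtype_coe.comp (UnitAddTorus.measurableEquivPiIoc (0 : Fin N → ℝ)).measurable
  have hRmem : ∀ y, R y ∈ cube N := by
    intro y
    have := (UnitAddTorus.measurableEquivPiIoc (0 : Fin N → ℝ) y).2
    refine ⟨fun i => (this i).1.le, fun i => ?_⟩
    have h2 := (this i).2
    simp only [Pi.zero_apply, zero_add] at h2
    exact h2
  have hRx : ∀ x : Pt N, (∀ i, x i ∈ Set.Ioc (0 : ℝ) 1) →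
      R (fun i => (x i : UnitAddCircle)) = x := by
    intro x hx
    have hx' : ∀ i, x i ∈ Set.Ioc ((0 : Fin N → ℝ) i) ((0 : Fin N → ℝ) i + 1) := by
      simpa using hx
    have := (UnitAddTorus.measurableEquivPiIoc (0 : Fin N → ℝ)).apply_symm_apply ⟨x, hx'⟩
    exact congrArg Subtype.val this
  set F : UnitAddTorus (Fin N) → ℂ := fun y => (f (R y) : ℂ) with hF
  have hFm : Measurable F := Complex.measurable_ofReal.comp (hf.measurable.comp hRm)
  obtain ⟨C, hC⟩ := (cube_compact N).exists_bound_of_continuousOn hf.continuousOn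
  have hFL : MemLp F 2 volume := by
    refine MemLp.of_bound hFm.aestronglyMeasurable C (Filter.Eventually.of_forall fun y => ?_)
    simpa [hF] using hC (R y) (hRmem y)
  have hP := UnitAddTorus.hasSum_sq_mFourierCoeff (hFL.toLp F)
  have e1 : ∫ t, ‖(hFL.toLp F) t‖ ^ 2 = ∫ x in cube N, f x ^ 2 := by
    have : ∫ t, ‖(hFL.toLp F) t‖ ^ 2 = ∫ t, ‖F t‖ ^ 2 := by
      refine integral_congr_ae ?_
      filter_upwards [hFL.coeFn_toLp] with t ht
      rw [ht]
    rw [this]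
    refine torus_integral _ _ fun x hx => ?_
    simp [hF, hRx x hx]
  have e2 : ∀ k, ‖UnitAddTorus.mFourierCoeff (hFL.toLp F) k‖ ^ 2 = cA f k ^ 2 + cB f k ^ 2 := by
    intro k
    have h1 : UnitAddTorus.mFourierCoeff (hFL.toLp F) k = UnitAddTorus.mFourierCoeff F k := by
      unfold UnitAddTorus.mFourierCoeff
      refine integral_congr_ae ?_
      filter_upwards [hFL.coeFn_toLp] with t ht
      rw [ht]
    have h2 : UnitAddTorus.mFourierCoeff F k =
        ∫ x in cube N, (((f x * cosK k x : ℝ) : ℂ) - ((f x * sinK k x : ℝ) : ℂ) * Complex.I) := by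
      refine torus_integral _ _ fun x hx => ?_
      simp only [hF, hRx x hx, mFourier_neg_mk, smul_eq_mul]
      push_cast
      ring
    have i1 : IntegrableOn (fun x => f x * cosK k x) (cube N) :=
      intOn (hf.mul (cosK_contDiff (n := 0) k).continuous)
    have i2 : IntegrableOn (fun x => f x * sinK k x) (cube N) :=
      intOn (hf.mul (sinK_contDiff (n := 0) k).continuous)
    have r1 : ∫ x in cube N, ((f x * cosK k x : ℝ) : ℂ) = ((cA f k : ℝ) : ℂ) := integral_ofReal
    have r2 : ∫ x in cube N, ((f x * sinK k x : ℝ) : ℂ) = ((cB f k : ℝ) : ℂ) := integral_ofReal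
    rw [h1, h2, integral_sub i1.ofReal (i2.ofReal.mul_const _), integral_mul_const,
      r1, r2, ← Complex.normSq_eq_norm_sq, Complex.normSq_apply]
    simp
    ring
  simp only [e2] at hP
  rw [← e1]
  exact hP

end Parseval

/-! ### The eigenvalue and Fourier coefficients of derivatives -/

/-- `|2πk|²` -/
def lam {N : ℕ} (k : Fin N → ℤ) : ℝ := 4 * π ^ 2 * ∑ i, ((k i : ℝ)) ^ 2

lemma lam_eq {N : ℕ} (k : Fin N → ℤ) : lam k = ∑ i, (2 * π * k i) ^ 2 := by
  unfold lam
  rw [Finset.mul_sum]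
  exact Finset.sum_congr rfl fun i _ => by ring

lemma lam_zero {N : ℕ} : lam (0 : Fin N → ℤ) = 0 := by simp [lam]

lemma lam_pos {N : ℕ} {k : Fin N → ℤ} (hk : k ≠ 0) : 0 < lam k := by
  obtain ⟨i, hi⟩ := Function.ne_iff.mp hk
  have hi' : (k i : ℝ) ≠ 0 := by exact_mod_cast hi
  unfold lam
  have : 0 < ∑ i, ((k i : ℝ)) ^ 2 :=
    Finset.sum_pos' (fun j _ => sq_nonneg _) ⟨i, Finset.mem_univ i, by positivity⟩
  have := Real.pi_pos
  positivity

lemma cA_pd {N : ℕ} (i : Fin N) {f : Pt N → ℝ} (hf : ContDiff ℝ 1 f) (hp : ZPeriodic f)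
    (k : Fin N → ℤ) : cA (pd i f) k = (2 * π * k i) * cB f k := by
  unfold cA cB
  rw [ibp i hf (cosK_contDiff k) hp (cosK_periodic k), ← integral_const_mul, ← integral_neg]
  congr 1
  ext x
  rw [pd_cosK]
  ring

lemma cB_pd {N : ℕ} (i : Fin N) {f : Pt N → ℝ} (hf : ContDiff ℝ 1 f) (hp : ZPeriodic f)
    (k : Fin N → ℤ) : cB (pd i f) k = -(2 * π * k i) * cA f k := by
  unfold cA cB
  rw [ibp i hf (sinK_contDiff k) hp (sinK_periodic k), ← integral_const_mul, ← integral_neg]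
  congr 1
  ext x
  rw [pd_sinK]
  ring

lemma gradSq_continuous {N : ℕ} {f : Pt N → ℝ} (hf : ContDiff ℝ 1 f) :
    Continuous (gradSq f) := by
  unfold gradSq
  exact continuous_finsetSum _ fun i _ => (pd_continuous i hf).pow 2

lemma parseval_grad {N : ℕ} {f : Pt N → ℝ} (hf : ContDiff ℝ 1 f) (hp : ZPeriodic f) :
    HasSum (fun k => lam k * (cA f k ^ 2 + cB f k ^ 2)) (∫ x in cube N, gradSq f x) := by
  have h := hasSum_sum (s := Finset.univ) (fun i _ => parseval (pd_continuous i hf))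
  unfold gradSq
  rw [integral_finsetSum _ fun i _ => intSq (pd_continuous i hf)]
  convert h using 2 with k
  rw [lam_eq, Finset.sum_mul]
  refine Finset.sum_congr rfl fun i _ => ?_
  rw [cA_pd i hf hp, cB_pd i hf hp]
  ring

lemma coeff_potential {N : ℕ} {u ψ : Pt N → ℝ} (h : IsPotential u ψ) (k : Fin N → ℤ) :
    cA u k = lam k * cA ψ k ∧ cB u k = lam k * cB ψ k := by
  obtain ⟨hψ, hp, -, hu⟩ := h
  have hψ1 : ContDiff ℝ 1 ψ := hψ.of_le (by norm_num)
  have hd : ∀ i, ContDiff ℝ 1 (pd i ψ) := fun i => pd_contDiff i (by simpa [one_add_one_eq_two] using hψ)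
  have hdp : ∀ i, ZPeriodic (pd i ψ) := fun i => pd_periodic i hp
  constructor
  · have : cA u k = -∑ i, cA (pd i (pd i ψ)) k := by
      unfold cA
      rw [← integral_finsetSum _ fun i _ =>
        intMul (pd_continuous i (hd i)) (cosK_contDiff (n := 0) k).continuous,
        ← integral_neg]
      congr 1
      ext x
      rw [← hu x, ← Finset.sum_mul]
      simp [lap, pd2]
    rw [this, lam_eq, Finset.sum_mul, ← Finset.sum_neg_distrib]
    refine Finset.sum_congr rfl fun i _ => ?_
    rw [cA_pd i (hd i) (hdp i), cB_pd i hψ1 hp]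
    ring
  · have : cB u k = -∑ i, cB (pd i (pd i ψ)) k := by
      unfold cB
      rw [← integral_finsetSum _ fun i _ =>
        intMul (pd_continuous i (hd i)) (sinK_contDiff (n := 0) k).continuous,
        ← integral_neg]
      congr 1
      ext x
      rw [← hu x, ← Finset.sum_mul]
      simp [lap, pd2]
    rw [this, lam_eq, Finset.sum_mul, ← Finset.sum_neg_distrib]
    refine Finset.sum_congr rfl fun i _ => ?_
    rw [cB_pd i (hd i) (hdp i), cA_pd i hψ1 hp]
    ring

lemma energy_split {N : ℕ} (a c : ℝ) {u ψ : Pt N → ℝ} (hu : ContDiff ℝ 1 u)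
    (hψ : ContDiff ℝ 1 ψ) :
    ∫ x in cube N, (a * gradSq u x + gradSq ψ x + c * (u x) ^ 2) =
      a * (∫ x in cube N, gradSq u x) + (∫ x in cube N, gradSq ψ x)
        + c * ∫ x in cube N, (u x) ^ 2 := by
  have i1 : IntegrableOn (fun x => a * gradSq u x) (cube N) :=
    intMul continuous_const (gradSq_continuous hu)
  have i2 := intOn (gradSq_continuous hψ)
  have i3 : IntegrableOn (fun x => c * u x ^ 2) (cube N) :=
    intMul continuous_const (hu.continuous.pow 2)
  have i12 : IntegrableOn (fun x => a * gradSq u x + gradSq ψ x) (cube N) := i1.add i2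
  rw [integral_add i12 i3, integral_add i1 i2, integral_const_mul, integral_const_mul]

/-! ### Test functions -/

lemma int_cosK_zero {N : ℕ} {k : Fin N → ℤ} (hk : k ≠ 0) : ∫ x in cube N, cosK k x = 0 := by
  obtain ⟨i, hi⟩ := Function.ne_iff.mp hk
  have hi' : (2 * π * (k i : ℝ)) ≠ 0 :=
    mul_ne_zero (by positivity) (by exact_mod_cast hi)
  have h := int_pd_zero i (sinK_contDiff k) (sinK_periodic k)
  simp only [pd_sinK, integral_const_mul] at h
  exact (mul_eq_zero.mp h).resolve_left hi'

lemma int_sin_sq {N : ℕ} {k : Fin N → ℤ} (hk : k ≠ 0) :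
    ∫ x in cube N, sinK k x ^ 2 = ∫ x in cube N, cosK k x ^ 2 := by
  obtain ⟨i, hi⟩ := Function.ne_iff.mp hk
  have hi' : (2 * π * (k i : ℝ)) ≠ 0 :=
    mul_ne_zero (by positivity) (by exact_mod_cast hi)
  have h := ibp i (cosK_contDiff k) (sinK_contDiff k) (cosK_periodic k) (sinK_periodic k)
  have e1 : ∫ x in cube N, pd i (cosK k) x * sinK k x
      = -(2 * π * k i) * ∫ x in cube N, sinK k x ^ 2 := by
    rw [← integral_const_mul]
    congr 1
    ext x
    rw [pd_cosK]
    ring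
  have e2 : ∫ x in cube N, cosK k x * pd i (sinK k) x
      = (2 * π * k i) * ∫ x in cube N, cosK k x ^ 2 := by
    rw [← integral_const_mul]
    congr 1
    ext x
    rw [pd_sinK]
    ring
  rw [e1, e2] at h
  exact mul_left_cancel₀ hi' (by linarith)

lemma int_cos_sq_pos {N : ℕ} {k : Fin N → ℤ} (hk : k ≠ 0) :
    0 < ∫ x in cube N, cosK k x ^ 2 := by
  have h1 : ∫ x in cube N, (cosK k x ^ 2 + sinK k x ^ 2) = 1 := by
    simp only [cosK, sinK, Real.cos_sq_add_sin_sq]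
    simp [cube, Measure.real, Real.volume_Icc_pi]
  rw [integral_add (intSq (cosK_contDiff (n := 0) k).continuous)
    (intSq (sinK_contDiff (n := 0) k).continuous), int_sin_sq hk] at h1
  linarith

lemma pd_const_mul {N : ℕ} (i : Fin N) (c : ℝ) {f : Pt N → ℝ} (hf : ContDiff ℝ 1 f) :
    pd i (fun x => c * f x) = fun x => c * pd i f x := by
  ext x
  unfold pd
  rw [fderiv_const_mul ((hf.differentiable one_ne_zero) x)]
  simp

lemma gradSq_cosK {N : ℕ} (k : Fin N → ℤ) (x : Pt N) :
    gradSq (cosK k) x = lam k * sinK k x ^ 2 := by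
  unfold gradSq
  rw [lam_eq, Finset.sum_mul]
  refine Finset.sum_congr rfl fun i _ => ?_
  rw [pd_cosK]
  ring

lemma isPotential_cosK {N : ℕ} {k : Fin N → ℤ} (hk : k ≠ 0) :
    IsPotential (cosK k) (fun x => (lam k)⁻¹ * cosK k x) := by
  refine ⟨contDiff_const.mul (cosK_contDiff k), fun x i => ?_, ?_, fun x => ?_⟩
  · simp only [cosK_periodic k x i]
  · rw [integral_const_mul, int_cosK_zero hk, mul_zero]
  · have h : ∀ i, pd2 i i (fun x => (lam k)⁻¹ * cosK k x) x
        = -((lam k)⁻¹ * ((2 * π * k i) ^ 2 * cosK k x)) := by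
      intro i
      unfold pd2
      rw [pd_const_mul i _ (cosK_contDiff k)]
      have : pd i (cosK k) = fun x => -(2 * π * k i) * sinK k x := funext fun x => pd_cosK k i x
      rw [pd_const_mul i _ (pd_contDiff i (n := 1) (cosK_contDiff k)), this,
        pd_const_mul i _ (sinK_contDiff k)]
      simp only [pd_sinK]
      ring
    unfold lap
    simp only [h]
    rw [Finset.sum_neg_distrib, neg_neg, ← Finset.mul_sum, ← Finset.sum_mul, ← lam_eq,
      inv_mul_cancel_left₀ (lam_pos hk).ne']

/-- Theorem 1.5, part 1: stability of the uniform state m for the Ohta–Kawasaki energy iff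
W''(m) + min_{k ∈ 2πℤ^N \ {0}} (|k|²/γ² + 1/|k|²) ≥ 0. -/
theorem OK_uniform_state_stable_iff (N : ℕ) (hN : 0 < N) (m γ : ℝ) (hγ : 0 < γ)
    (W : ℝ → ℝ) (hW : ContDiff ℝ 2 W) :
    (∀ u ψ : Pt N → ℝ, ContDiff ℝ 1 u → ZPeriodic u → (∫ x in cube N, u x) = 0 →
        IsPotential u ψ →
        0 ≤ ∫ x in cube N,
          ((1/γ^2) * gradSq u x + gradSq ψ x + iteratedDeriv 2 W m * (u x)^2)) ↔
      0 ≤ iteratedDeriv 2 W m + freqMinOK N γ := by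
  set c := iteratedDeriv 2 W m with hc
  constructor
  · intro H
    have hne : {t : ℝ | ∃ k : Fin N → ℤ, k ≠ 0 ∧
        t = (4*π^2 * ∑ i, ((k i : ℝ))^2) / γ^2 + 1 / (4*π^2 * ∑ i, ((k i : ℝ))^2)}.Nonempty := by
      refine ⟨_, fun _ => 1, ?_, rfl⟩
      intro h
      simpa using congrFun h ⟨0, hN⟩
    have : -c ≤ freqMinOK N γ := by
      refine le_csInf hne ?_
      rintro t ⟨k, hk, rfl⟩
      change -c ≤ lam k / γ ^ 2 + 1 / lam k
      have hl := lam_pos hk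
      have hE := H (cosK k) _ (cosK_contDiff k) (cosK_periodic k) (int_cosK_zero hk)
        (isPotential_cosK hk)
      rw [energy_split _ _ (cosK_contDiff k) (contDiff_const.mul (cosK_contDiff k))] at hE
      have g2 : ∀ x, gradSq (fun x => (lam k)⁻¹ * cosK k x) x
          = (lam k)⁻¹ * sinK k x ^ 2 := by
        intro x
        have : gradSq (fun x => (lam k)⁻¹ * cosK k x) x = (lam k)⁻¹ ^ 2 * gradSq (cosK k) x := by
          unfold gradSq
          rw [Finset.mul_sum]
          refine Finset.sum_congr rfl fun i _ => ?_
          rw [pd_const_mul i _ (cosK_contDiff k)]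
          ring
        rw [this, gradSq_cosK]
        field_simp
      simp only [g2, gradSq_cosK, integral_const_mul, int_sin_sq hk] at hE
      have hpos := int_cos_sq_pos hk
      have : 0 ≤ (lam k / γ ^ 2 + 1 / lam k + c) * ∫ x in cube N, cosK k x ^ 2 := by
        refine hE.trans (le_of_eq ?_)
        ring
      have := nonneg_of_mul_nonneg_left this hpos
      linarith
    linarith
  · intro H u ψ hu hup _ hpot
    have hψ1 : ContDiff ℝ 1 ψ := hpot.1.of_le (by norm_num)
    rw [energy_split _ _ hu hψ1]
    have hs := (((parseval_grad hu hup).mul_left (1 / γ ^ 2)).add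
      (parseval_grad hψ1 hpot.2.1)).add ((parseval hu.continuous).mul_left c)
    refine hs.nonneg fun k => ?_
    obtain ⟨hA, hB⟩ := coeff_potential hpot k
    by_cases hk : k = 0
    · subst hk
      simp [hA, hB, lam_zero]
    · have hl := lam_pos hk
      have hle : freqMinOK N γ ≤ lam k / γ ^ 2 + 1 / lam k := by
        refine csInf_le ⟨0, ?_⟩ ⟨k, hk, rfl⟩
        rintro t ⟨j, hj, rfl⟩
        change 0 ≤ lam j / γ ^ 2 + 1 / lam j
        have := lam_pos hj
        positivity
      have h0 : 0 ≤ lam k / γ ^ 2 + 1 / lam k + c := by linarith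
      have : 0 ≤ lam k ^ 2 * (cA ψ k ^ 2 + cB ψ k ^ 2) * (lam k / γ ^ 2 + 1 / lam k + c) := by
        positivity
      refine this.trans (le_of_eq ?_)
      rw [hA, hB]
      field_simp

end
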